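/- Let u* ∈ (0,1), t > 0, and let α > 0 satisfy the Stefan shock equation (1 − u*)/√π = u*·erf(α)·α·exp(α²), with 2α√t ≤ 1. Then the truncated Stefan solution satisfies the conservation law ∫₀^{2α√t} ( 1 − (1 − u*)·erf(x/(2√t))/erf(α) ) dx = (2(1 − u*)/erf(α))·√(t/π); equivalently, ∫₀¹ u(x,t) dx = 2(1 − u*)/erf(α) · √(t/π), where u(x,t) equals the Stefan profile for x ≤ 2α√t and 0 for x > 2α√t. -/

import Mathlib

/-- The error function `erf z = (2/√π) ∫₀^z exp(−s²) ds`. -/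
noncomputable def erf (z : ℝ) : ℝ :=
  (2 / Real.sqrt Real.pi) * ∫ s in (0 : ℝ)..z, Real.exp (-(s ^ 2))

theorem erf_hasDerivAt_aux (y : ℝ) :
    HasDerivAt erf (2 / Real.sqrt Real.pi * Real.exp (-(y ^ 2))) y := by
  have hc : Continuous (fun s : ℝ => Real.exp (-(s ^ 2))) := by fun_prop
  exact (hc.integral_hasStrictDerivAt 0 y).hasDerivAt.const_mul _

theorem erf_prim_aux (y : ℝ) :
    HasDerivAt (fun y => y * erf y + Real.exp (-(y ^ 2)) / Real.sqrt Real.pi) (erf y) y := by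
  have h1 := (hasDerivAt_id y).mul (erf_hasDerivAt_aux y)
  have h2 := (((hasDerivAt_pow 2 y).neg).exp).div_const (Real.sqrt Real.pi)
  have h3 := h1.add h2
  refine h3.congr_deriv ?_
  simp
  ring

/-- **Conservation law for the truncated Stefan solution.**
Let `u* ∈ (0,1)`, `t > 0`, and let `α > 0` satisfy the Stefan shock equation
`(1 − u*)/√π = u*·erf(α)·α·exp(α²)`, with `2α√t ≤ 1`.  Then
`∫₀^{2α√t} (1 − (1 − u*)·erf(x/(2√t))/erf(α)) dx = (2(1 − u*)/erf(α))·√(t/π)`;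
equivalently, `∫₀¹ u(x,t) dx = (2(1 − u*)/erf(α))·√(t/π)` where `u(x,t)` equals
the Stefan profile for `x ≤ 2α√t` and `0` for `x > 2α√t`. -/
theorem stefan_solution_conservation (ustar : ℝ) (hustar : ustar ∈ Set.Ioo (0 : ℝ) 1)
    (t : ℝ) (ht : 0 < t) (α : ℝ) (hα : 0 < α)
    (hshock : (1 - ustar) / Real.sqrt Real.pi =
      ustar * (erf α * α * Real.exp (α ^ 2)))
    (hfront : 2 * α * Real.sqrt t ≤ 1) :
    (∫ x in (0 : ℝ)..(2 * α * Real.sqrt t),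
        (1 - (1 - ustar) * erf (x / (2 * Real.sqrt t)) / erf α)) =
      (2 * (1 - ustar) / erf α) * Real.sqrt (t / Real.pi) ∧
    (∫ x in (0 : ℝ)..1,
        (if x ≤ 2 * α * Real.sqrt t then
          1 - (1 - ustar) * erf (x / (2 * Real.sqrt t)) / erf α
        else 0)) =
      (2 * (1 - ustar) / erf α) * Real.sqrt (t / Real.pi) := by
  have hu : (1 - ustar) ≠ 0 := by have := hustar.2; linarith
  have hpi : 0 < Real.sqrt Real.pi := Real.sqrt_pos.mpr Real.pi_pos
  have hs : 0 < Real.sqrt t := Real.sqrt_pos.mpr ht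
  have he : erf α ≠ 0 := by
    intro h
    rw [h] at hshock
    have : (1 - ustar) / Real.sqrt Real.pi ≠ 0 := div_ne_zero hu hpi.ne'
    apply this
    rw [hshock]; ring
  have hcont : Continuous erf :=
    continuous_iff_continuousAt.mpr fun y => (erf_hasDerivAt_aux y).continuousAt
  have key : (∫ x in (0 : ℝ)..(2 * α * Real.sqrt t),
        (1 - (1 - ustar) * erf (x / (2 * Real.sqrt t)) / erf α)) =
      (2 * (1 - ustar) / erf α) * Real.sqrt (t / Real.pi) := by
    have hd : ∀ x ∈ Set.uIcc 0 (2 * α * Real.sqrt t), HasDerivAt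
        (fun x => x - (1 - ustar) / erf α * (2 * Real.sqrt t) *
          ((x / (2 * Real.sqrt t)) * erf (x / (2 * Real.sqrt t)) +
            Real.exp (-((x / (2 * Real.sqrt t)) ^ 2)) / Real.sqrt Real.pi))
        (1 - (1 - ustar) * erf (x / (2 * Real.sqrt t)) / erf α) x := by
      intro x _
      have h1 := (erf_prim_aux (x / (2 * Real.sqrt t))).comp x
        ((hasDerivAt_id x).div_const (2 * Real.sqrt t))
      have h2 := (hasDerivAt_id x).sub
        (h1.const_mul ((1 - ustar) / erf α * (2 * Real.sqrt t)))
      refine h2.congr_deriv ?_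
      field_simp
    rw [intervalIntegral.integral_eq_sub_of_hasDerivAt hd
      (Continuous.intervalIntegrable (by fun_prop) _ _)]
    have e1 : 2 * α * Real.sqrt t / (2 * Real.sqrt t) = α := by field_simp
    rw [e1, Real.sqrt_div ht.le, Real.exp_neg]
    have hx : Real.exp (α ^ 2) ≠ 0 := (Real.exp_pos _).ne'
    have h5 : 1 - ustar = ustar * (erf α * α * Real.exp (α ^ 2)) * Real.sqrt Real.pi := by
      rw [← hshock]; field_simp
    simp
    generalize Real.exp (α ^ 2) = E at *
    generalize erf α = r at *
    generalize Real.sqrt Real.pi = q at *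
    generalize Real.sqrt t = s at *
    field_simp
    linear_combination (-1) * h5
  refine ⟨key, ?_⟩
  have h0 : (0 : ℝ) ≤ 2 * α * Real.sqrt t := by positivity
  have i1 : Set.EqOn (fun x => if x ≤ 2 * α * Real.sqrt t then
          1 - (1 - ustar) * erf (x / (2 * Real.sqrt t)) / erf α
        else 0) (fun x => 1 - (1 - ustar) * erf (x / (2 * Real.sqrt t)) / erf α)
        (Set.uIoc 0 (2 * α * Real.sqrt t)) := by
    intro x hx
    rw [Set.uIoc_of_le h0] at hx
    simp only [if_pos hx.2]
  have i2 : Set.EqOn (fun x => if x ≤ 2 * α * Real.sqrt t then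
          1 - (1 - ustar) * erf (x / (2 * Real.sqrt t)) / erf α
        else 0) (fun _ => 0) (Set.uIoc (2 * α * Real.sqrt t) 1) := by
    intro x hx
    rw [Set.uIoc_of_le hfront] at hx
    simp only [if_neg (not_le.mpr hx.1)]
  have j1 : IntervalIntegrable (fun x => 1 - (1 - ustar) * erf (x / (2 * Real.sqrt t)) / erf α)
      MeasureTheory.volume 0 (2 * α * Real.sqrt t) :=
    Continuous.intervalIntegrable (by fun_prop) _ _
  have j2 : IntervalIntegrable (fun _ : ℝ => (0 : ℝ))
      MeasureTheory.volume (2 * α * Real.sqrt t) 1 :=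
    Continuous.intervalIntegrable (by fun_prop) _ _
  rw [← intervalIntegral.integral_add_adjacent_intervals (j1.congr i1.symm) (j2.congr i2.symm),
    intervalIntegral.integral_congr_ae (Filter.Eventually.of_forall i1), intervalIntegral.integral_congr_ae (Filter.Eventually.of_forall i2), key]
  simp
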